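/- arXiv:1708.01861 — 2 statements merged into one kernel-verified Lean document; each statement's English description precedes it below -/
import Mathlib

section
/- (Corollary 1, sequential decomposition.) Fix integers m ≥ 1, n ≥ 1, reals ν > m−1, ρ² > 0, a vector μ₀ ∈ ℝ^m and a positive definite Σ₀ ∈ ℝ^{m×m}. The LNML density p̄_n of Theorem 2 factorizes as p̄_n(x^n) = ∏_{i=1}^n t_{ν−m+i}(x_i | μ̄_{i−1}, ((ρ²ν+i)(ν+i−1))/((ρ²ν+i−1)(ν−m+i)) · Σ̄_{i−1}), where μ̄_k and Σ̄_k are the MAP estimates computed from the first k observations (with μ̄_0 = μ₀ and Σ̄_0 = Σ₀), and t_d(x|μ,S) denotes the density of the m-variate Student t-distribution with d degrees of freedom, location μ and scale matrix S, namely t_d(x|μ,S) = Γ((d+m)/2)/(Γ(d/2)·(dπ)^{m/2}·|S|^{1/2}) · (1 + (1/d)(x−μ)ᵀS⁻¹(x−μ))^{−(d+m)/2}. -/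
open MeasureTheory Matrix Real BigOperators

/-- Likelihood of `n` observations under the `m`-dimensional normal distribution
with mean `μ` and covariance `S`. -/
noncomputable def mvnLik (m n : ℕ) (x : Fin n → Fin m → ℝ) (μ : Fin m → ℝ)
    (S : Matrix (Fin m) (Fin m) ℝ) : ℝ :=
  ∏ i : Fin n, (2 * π) ^ (-(m : ℝ) / 2) * S.det ^ (-(1 : ℝ) / 2) *
    Real.exp (-(1 / 2) * ((x i - μ) ⬝ᵥ (S⁻¹ *ᵥ (x i - μ))))

/-- The simple luckiness function `π(μ, Σ; ν, σ², ρ²)`. -/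
noncomputable def luck (m : ℕ) (μ : Fin m → ℝ) (S : Matrix (Fin m) (Fin m) ℝ)
    (ν σ2 ρ2 : ℝ) : ℝ :=
  (2 * π) ^ (-(m : ℝ) * ν / 2) * S.det ^ (-ν / 2) *
    Real.exp (-(ν / 2) *
      (S⁻¹ * (σ2 • (1 : Matrix (Fin m) (Fin m) ℝ) + ρ2 • vecMulVec μ μ)).trace)

/-- The generalized luckiness function `π(μ, Σ; ν, μ₀, Σ₀, ρ²)`. -/
noncomputable def luck2 (m : ℕ) (μ : Fin m → ℝ) (S : Matrix (Fin m) (Fin m) ℝ)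
    (ν : ℝ) (μ0 : Fin m → ℝ) (S0 : Matrix (Fin m) (Fin m) ℝ) (ρ2 : ℝ) : ℝ :=
  (2 * π) ^ (-(m : ℝ) * ν / 2) * S.det ^ (-ν / 2) *
    Real.exp (-(ν / 2) *
      (S⁻¹ * (S0 + ρ2 • vecMulVec (μ - μ0) (μ - μ0))).trace)

/-- MAP location estimate `μ̄_k` for the simple luckiness. -/
noncomputable def muBar (m k : ℕ) (ν ρ2 : ℝ) (x : Fin k → Fin m → ℝ) : Fin m → ℝ :=
  (1 / (k + ρ2 * ν)) • ∑ i : Fin k, x i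

/-- MAP covariance estimate `Σ̄_k` for the simple luckiness. -/
noncomputable def sigmaBar (m k : ℕ) (ν σ2 ρ2 : ℝ) (x : Fin k → Fin m → ℝ) :
    Matrix (Fin m) (Fin m) ℝ :=
  (1 / (k + ν)) •
      (∑ i : Fin k, vecMulVec (x i) (x i) + (ν * σ2) • (1 : Matrix (Fin m) (Fin m) ℝ))
    - (1 / ((ν + k) * (ρ2 * ν + k))) • ∑ i : Fin k, ∑ j : Fin k, vecMulVec (x i) (x j)

/-- MAP location estimate `μ̄_k` for the generalized luckiness. -/
noncomputable def muBar2 (m k : ℕ) (ν ρ2 : ℝ) (μ0 : Fin m → ℝ)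
    (x : Fin k → Fin m → ℝ) : Fin m → ℝ :=
  μ0 + (1 / (k + ρ2 * ν)) • ∑ i : Fin k, (x i - μ0)

/-- MAP covariance estimate `Σ̄_k` for the generalized luckiness. -/
noncomputable def sigmaBar2 (m k : ℕ) (ν ρ2 : ℝ) (μ0 : Fin m → ℝ)
    (S0 : Matrix (Fin m) (Fin m) ℝ) (x : Fin k → Fin m → ℝ) : Matrix (Fin m) (Fin m) ℝ :=
  (1 / (k + ν)) • (∑ i : Fin k, vecMulVec (x i - μ0) (x i - μ0) + ν • S0)
    - (1 / ((ν + k) * (ρ2 * ν + k))) •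
        ∑ i : Fin k, ∑ j : Fin k, vecMulVec (x i - μ0) (x j - μ0)

/-- The multivariate gamma function `Γ_m(z)`. -/
noncomputable def multiGamma (m : ℕ) (z : ℝ) : ℝ :=
  π ^ ((m : ℝ) * ((m : ℝ) - 1) / 4) * ∏ j : Fin m, Real.Gamma (z - (j : ℝ) / 2)

/-- The capacity `𝒞(m, n, ν, σ², ρ²)` (note: the fourth argument is `σ²`,
so `σ^{-mν} = (σ²)^{-mν/2}`). -/
noncomputable def capC (m n : ℕ) (ν σ2 ρ2 : ℝ) : ℝ :=
  σ2 ^ (-(m : ℝ) * ν / 2) *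
    ((((n : ℝ) + ν) ^ ((n : ℝ) + ν) * (1 + n / (ρ2 * ν))) /
        ((2 * Real.exp 1) ^ ((n : ℝ) + ν) * (π * ν) ^ ν)) ^ ((m : ℝ) / 2) *
    (multiGamma m (ν / 2) / multiGamma m (((n : ℝ) + ν) / 2))

/-- The pointwise supremum of likelihood times simple luckiness over all `μ`
and positive definite `Σ`. -/
noncomputable def supLik (m n : ℕ) (ν σ2 ρ2 : ℝ) (x : Fin n → Fin m → ℝ) : ℝ :=
  ⨆ p : (Fin m → ℝ) × {S : Matrix (Fin m) (Fin m) ℝ // S.PosDef},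
    mvnLik m n x p.1 p.2.1 * luck m p.1 p.2.1 ν σ2 ρ2

/-- The pointwise supremum of likelihood times generalized luckiness over all `μ`
and positive definite `Σ`. -/
noncomputable def supLik2 (m n : ℕ) (ν : ℝ) (μ0 : Fin m → ℝ)
    (S0 : Matrix (Fin m) (Fin m) ℝ) (ρ2 : ℝ) (x : Fin n → Fin m → ℝ) : ℝ :=
  ⨆ p : (Fin m → ℝ) × {S : Matrix (Fin m) (Fin m) ℝ // S.PosDef},
    mvnLik m n x p.1 p.2.1 * luck2 m p.1 p.2.1 ν μ0 S0 ρ2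

/-- The density of the `m`-variate Student t-distribution with `d` degrees of
freedom, location `μ` and scale matrix `S`. -/
noncomputable def tDens (m : ℕ) (d : ℝ) (x μ : Fin m → ℝ)
    (S : Matrix (Fin m) (Fin m) ℝ) : ℝ :=
  Real.Gamma ((d + m) / 2) /
      (Real.Gamma (d / 2) * (d * π) ^ ((m : ℝ) / 2) * S.det ^ ((1 : ℝ) / 2)) *
    (1 + (1 / d) * ((x - μ) ⬝ᵥ (S⁻¹ *ᵥ (x - μ)))) ^ (-(d + (m : ℝ)) / 2)

/-- The unnormalized MAP scatter matrix `(k + ν) Σ̄_k`. -/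
noncomputable def scatterMatrix (m k : ℕ) (ν ρ2 : ℝ) (μ0 : Fin m → ℝ)
    (S0 : Matrix (Fin m) (Fin m) ℝ) (x : Fin k → Fin m → ℝ) : Matrix (Fin m) (Fin m) ℝ :=
  ν • S0 + ∑ i : Fin k, vecMulVec (x i - μ0) (x i - μ0)
    - (1 / (ρ2 * ν + k)) • vecMulVec (∑ i : Fin k, (x i - μ0)) (∑ i : Fin k, (x i - μ0))

theorem sigmaBar2_eq_smul_scatterMatrix (m k : ℕ) (ν ρ2 : ℝ) (μ0 : Fin m → ℝ)
    (S0 : Matrix (Fin m) (Fin m) ℝ) (x : Fin k → Fin m → ℝ) :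
    sigmaBar2 m k ν ρ2 μ0 S0 x = (1 / (ν + k)) • scatterMatrix m k ν ρ2 μ0 S0 x := by
  ext p q
  simp only [sigmaBar2, scatterMatrix, Matrix.sub_apply, Matrix.add_apply,
    Matrix.smul_apply, Matrix.sum_apply,
    vecMulVec_apply, Finset.sum_apply, smul_eq_mul, Finset.sum_mul_sum, one_div, mul_inv,
    add_comm (k : ℝ) ν]
  ring

theorem scatterMatrix_zero (m : ℕ) (ν ρ2 : ℝ) (μ0 : Fin m → ℝ)
    (S0 : Matrix (Fin m) (Fin m) ℝ) (x : Fin 0 → Fin m → ℝ) :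
    scatterMatrix m 0 ν ρ2 μ0 S0 x = ν • S0 := by
  simp [scatterMatrix]

/-- Rank-one update of the scatter matrix when one more observation arrives. -/
theorem scatterMatrix_succ (m k : ℕ) (ν ρ2 : ℝ) (h : 0 < ρ2 * ν) (μ0 : Fin m → ℝ)
    (S0 : Matrix (Fin m) (Fin m) ℝ) (x : Fin (k + 1) → Fin m → ℝ) :
    scatterMatrix m (k + 1) ν ρ2 μ0 S0 x
      = scatterMatrix m k ν ρ2 μ0 S0 (fun j => x j.castSucc)
        + ((ρ2 * ν + k) / (ρ2 * ν + k + 1)) •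
          vecMulVec (x (Fin.last k) - muBar2 m k ν ρ2 μ0 (fun j => x j.castSucc))
            (x (Fin.last k) - muBar2 m k ν ρ2 μ0 (fun j => x j.castSucc)) := by
  have h1 : ρ2 * ν + k ≠ 0 := by positivity
  have h2 : ρ2 * ν + k + 1 ≠ 0 := by positivity
  ext p q
  simp only [scatterMatrix, muBar2, Matrix.sub_apply, Matrix.add_apply,
    Matrix.smul_apply, Matrix.sum_apply,
    vecMulVec_apply, Finset.sum_apply, smul_eq_mul, Fin.sum_univ_castSucc, Pi.sub_apply,
    Pi.add_apply, Pi.smul_apply, Nat.cast_add, Nat.cast_one, add_comm (k : ℝ) (ρ2 * ν),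
    ← add_assoc]
  generalize ∑ i : Fin k, (x i.castSucc p - μ0 p) = s
  generalize ∑ i : Fin k, (x i.castSucc q - μ0 q) = t
  generalize ρ2 * ν + k = a at *
  field_simp
  ring

theorem scatterMatrix_posDef (m k : ℕ) (ν ρ2 : ℝ) (hν : 0 < ν) (hρ : 0 < ρ2) (μ0 : Fin m → ℝ)
    (S0 : Matrix (Fin m) (Fin m) ℝ) (hS0 : S0.PosDef) (x : Fin k → Fin m → ℝ) :
    (scatterMatrix m k ν ρ2 μ0 S0 x).PosDef := by
  induction k with
  | zero => rw [scatterMatrix_zero]; exact hS0.smul hν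
  | succ k ih =>
    rw [scatterMatrix_succ m k ν ρ2 (by positivity)]
    refine (ih _).add_posSemidef (PosSemidef.smul ?_ (by positivity))
    simpa using posSemidef_vecMulVec_self_star
      (x (Fin.last k) - muBar2 m k ν ρ2 μ0 (fun j => x j.castSucc))

theorem det_add_smul_vecMulVec {m : Type*} [Fintype m] [DecidableEq m] {A : Matrix m m ℝ}
    (hA : IsUnit A.det) (r : ℝ) (u : m → ℝ) :
    (A + r • vecMulVec u u).det = A.det * (1 + r * (u ⬝ᵥ (A⁻¹ *ᵥ u))) := by
  rw [← smul_vecMulVec, vecMulVec_eq Unit, det_add_replicateCol_mul_replicateRow hA, Matrix.mul_assoc,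
    ← replicateCol_mulVec, det_unique (n := Unit), Matrix.add_apply,
    replicateRow_mul_replicateCol_apply, mulVec_smul, dotProduct_smul]
  simp

theorem multiGamma_pos (m : ℕ) (z : ℝ) (hz : ((m : ℝ) - 1) / 2 < z) : 0 < multiGamma m z := by
  refine mul_pos (by positivity) (Finset.prod_pos fun j _ => Real.Gamma_pos_of_pos ?_)
  have : ((j : ℕ) : ℝ) + 1 ≤ m := by exact_mod_cast j.isLt
  linarith

theorem multiGamma_add_half (m : ℕ) (c : ℝ) :
    multiGamma m ((c + 1) / 2) * Real.Gamma ((c + 1 - m) / 2)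
      = multiGamma m (c / 2) * Real.Gamma ((c + 1) / 2) := by
  have h := (Finset.prod_range_succ (fun j : ℕ => Real.Gamma ((c + 1) / 2 - (j : ℝ) / 2)) m).symm.trans
    (Finset.prod_range_succ' _ m)
  have e : ∀ j : ℕ, (c + 1) / 2 - ((j + 1 : ℕ) : ℝ) / 2 = c / 2 - (j : ℝ) / 2 := by
    intro j; push_cast; ring
  simp only [e, Nat.cast_zero, zero_div, sub_zero] at h
  simp only [multiGamma, mul_assoc]
  rw [Fin.prod_univ_eq_prod_range (fun j : ℕ => Real.Gamma ((c + 1) / 2 - (j : ℝ) / 2)),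
    Fin.prod_univ_eq_prod_range (fun j : ℕ => Real.Gamma (c / 2 - (j : ℝ) / 2)), ← h, sub_div]

theorem exists_eq_exp {y : ℝ} (hy : 0 < y) : ∃ z, y = Real.exp z :=
  ⟨Real.log y, (Real.exp_log hy).symm⟩

/-- The Student density with a scale matrix proportional to `M`, in terms of the determinant of
the rank-one update of `M`. -/
theorem tDens_eq_det_ratio (m : ℕ) (d a : ℝ) (hd : 0 < d) (ha : 0 < a) (x μ : Fin m → ℝ)
    (M : Matrix (Fin m) (Fin m) ℝ) (hM : M.PosDef) :
    tDens m d x μ (((a + 1) / (a * d)) • M)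
      = Real.Gamma ((d + m) / 2) / Real.Gamma (d / 2) * π ^ (-(m : ℝ) / 2) *
          (a / (a + 1)) ^ ((m : ℝ) / 2) *
          (M.det ^ ((d + m - 1) / 2) /
            (M + (a / (a + 1)) • vecMulVec (x - μ) (x - μ)).det ^ ((d + m) / 2)) := by
  have hu : IsUnit M.det := hM.det_pos.ne'.isUnit
  have hr : (a + 1) / (a * d) ≠ 0 := by positivity
  have hinv : (((a + 1) / (a * d)) • M)⁻¹ = ((a + 1) / (a * d))⁻¹ • M⁻¹ :=
    Matrix.inv_smul' M (Units.mk0 _ hr) hu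
  have hq : 0 ≤ (x - μ) ⬝ᵥ (M⁻¹ *ᵥ (x - μ)) := by
    simpa using hM.inv.posSemidef.dotProduct_mulVec_nonneg (x - μ)
  have hdet := hM.det_pos
  rw [tDens, det_add_smul_vecMulVec hu, hinv, det_smul, Fintype.card_fin, smul_mulVec,
    dotProduct_smul, smul_eq_mul, ← Real.rpow_natCast _ m]
  have hbase : 1 + 1 / d * (((a + 1) / (a * d))⁻¹ * ((x - μ) ⬝ᵥ (M⁻¹ *ᵥ (x - μ))))
      = 1 + a / (a + 1) * ((x - μ) ⬝ᵥ (M⁻¹ *ᵥ (x - μ))) := by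
    field_simp
  rw [hbase]
  have hb : 0 < 1 + a / (a + 1) * ((x - μ) ⬝ᵥ (M⁻¹ *ᵥ (x - μ))) := by positivity
  generalize 1 + a / (a + 1) * ((x - μ) ⬝ᵥ (M⁻¹ *ᵥ (x - μ))) = b at *
  generalize M.det = D at *
  generalize Real.Gamma ((d + m) / 2) = g₁
  generalize Real.Gamma (d / 2) = g₂
  have ha1 : 0 < a + 1 := by positivity
  obtain ⟨lp, hlp⟩ := exists_eq_exp Real.pi_pos
  obtain ⟨lb, rfl⟩ := exists_eq_exp hb
  obtain ⟨lD, rfl⟩ := exists_eq_exp hdet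
  obtain ⟨la1, hla1⟩ := exists_eq_exp ha1
  obtain ⟨la, hla⟩ := exists_eq_exp ha
  obtain ⟨ld, hld⟩ := exists_eq_exp hd
  have hdp : d * π = Real.exp (ld + lp) := by rw [Real.exp_add, ← hld, ← hlp]
  have h1 : (a + 1) / (a * d) = Real.exp (la1 - (la + ld)) := by
    rw [Real.exp_sub, Real.exp_add, ← hld, ← hla1, ← hla]
  have h2 : a / (a + 1) = Real.exp (la - la1) := by
    rw [Real.exp_sub, ← hla1, ← hla]
  rw [hdp, h1, h2, hlp]
  simp only [← Real.exp_mul, ← Real.exp_add, ← Real.exp_sub, mul_assoc]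
  rw [← div_div, div_eq_mul_inv (g₁ / g₂), ← Real.exp_neg, mul_assoc, ← Real.exp_add]
  congr 2
  ring

/-- The LNML density in terms of the scatter matrix, as a product of Student densities. -/
theorem scatterMatrix_ratio_eq_prod_tDens (m n : ℕ) (ν ρ2 : ℝ)
    (hm : 1 ≤ m) (hν : (m : ℝ) - 1 < ν) (hρ : 0 < ρ2)
    (μ0 : Fin m → ℝ) (S0 : Matrix (Fin m) (Fin m) ℝ) (hS0 : S0.PosDef)
    (x : Fin n → Fin m → ℝ) :
    (ρ2 * ν / (ρ2 * ν + n)) ^ ((m : ℝ) / 2) * π ^ (-(m : ℝ) / 2 * n) *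
      (multiGamma m ((ν + n) / 2) / multiGamma m (ν / 2)) *
      ((ν • S0).det ^ (ν / 2) / (scatterMatrix m n ν ρ2 μ0 S0 x).det ^ ((ν + n) / 2))
    = ∏ i : Fin n,
        tDens m (ν - m + (i : ℕ) + 1) (x i)
          (muBar2 m (i : ℕ) ν ρ2 μ0 (fun j => x (Fin.castLE i.isLt.le j)))
          ((((ρ2 * ν + (i : ℕ) + 1) * (ν + (i : ℕ))) /
              ((ρ2 * ν + (i : ℕ)) * (ν - m + (i : ℕ) + 1))) •
            sigmaBar2 m (i : ℕ) ν ρ2 μ0 S0 (fun j => x (Fin.castLE i.isLt.le j))) := by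
  have hm' : (1 : ℝ) ≤ m := by exact_mod_cast hm
  have hν0 : 0 < ν := by linarith
  have ha0 : 0 < ρ2 * ν := by positivity
  have hg (k : ℕ) : 0 < multiGamma m ((ν + k) / 2) :=
    multiGamma_pos m _ (by have : (0 : ℝ) ≤ k := k.cast_nonneg; linarith)
  have hgν : 0 < multiGamma m (ν / 2) := multiGamma_pos m _ (by linarith)
  induction n with
  | zero =>
    have hdet : 0 < (ν • S0).det := (hS0.smul hν0).det_pos
    have h := (Real.rpow_pos_of_pos hdet (ν / 2)).ne'
    rw [scatterMatrix_zero, Nat.cast_zero, add_zero, add_zero, div_self ha0.ne', div_self hgν.ne',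
      div_self h]
    simp
  | succ n ih =>
    rw [Fin.prod_univ_castSucc]
    set M := scatterMatrix m n ν ρ2 μ0 S0 (fun j => x j.castSucc) with hM
    have hMpos : M.PosDef := scatterMatrix_posDef m n ν ρ2 hν0 hρ μ0 S0 hS0 _
    have hn : (0 : ℝ) ≤ n := n.cast_nonneg
    have hd : 0 < ν - m + n + 1 := by linarith
    have ha : 0 < ρ2 * ν + n := by positivity
    have hc : ν + n ≠ 0 := by positivity
    have hcoef : (ρ2 * ν + n + 1) * (ν + n) / ((ρ2 * ν + n) * (ν - m + n + 1)) * (1 / (ν + n))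
        = (ρ2 * ν + n + 1) / ((ρ2 * ν + n) * (ν - m + n + 1)) := by
      field_simp
    have ht := tDens_eq_det_ratio m (ν - m + n + 1) (ρ2 * ν + n) hd ha (x (Fin.last n))
      (muBar2 m n ν ρ2 μ0 (fun j => x j.castSucc)) M hMpos
    rw [← scatterMatrix_succ m n ν ρ2 ha0, ← hcoef, ← smul_smul, hM,
      ← sigmaBar2_eq_smul_scatterMatrix, ← hM] at ht
    refine Eq.trans ?_ (congrArg₂ (· * ·) (ih fun j => x j.castSucc) ht.symm)
    have hG := multiGamma_add_half m (ν + n)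
    have hΓ : Real.Gamma ((ν + n + 1 - m) / 2) ≠ 0 :=
      (Real.Gamma_pos_of_pos (by linarith)).ne'
    have hratio : multiGamma m ((ν + n + 1) / 2) = multiGamma m ((ν + n) / 2) *
        (Real.Gamma ((ν + n + 1) / 2) / Real.Gamma ((ν + n + 1 - m) / 2)) := by
      rw [mul_div_assoc', eq_div_iff hΓ, hG]
    have ha_ratio : ρ2 * ν / (ρ2 * ν + n + 1)
        = ρ2 * ν / (ρ2 * ν + n) * ((ρ2 * ν + n) / (ρ2 * ν + n + 1)) := by
      field_simp
    have hpi : π ^ (-(m : ℝ) / 2 * (n + 1)) = π ^ (-(m : ℝ) / 2 * n) * π ^ (-(m : ℝ) / 2) := by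
      rw [← Real.rpow_add Real.pi_pos]; ring_nf
    have hMn : M.det ^ ((ν + n) / 2) ≠ 0 := (Real.rpow_pos_of_pos hMpos.det_pos _).ne'
    rw [show ν - m + n + 1 + m - 1 = ν + n by ring, show ν - m + n + 1 + m = ν + n + 1 by ring,
      show ν - m + n + 1 = ν + n + 1 - m by ring]
    rw [Nat.cast_add, Nat.cast_one, ← add_assoc, ← add_assoc, hratio, ha_ratio, hpi,
      Real.mul_rpow (by positivity) (by positivity), ← hM]
    generalize (scatterMatrix m (n + 1) ν ρ2 μ0 S0 x).det ^ ((ν + n + 1) / 2) = Dn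
    generalize M.det ^ ((ν + n) / 2) = D at *
    field_simp

/-- Corollary 1: sequential decomposition of the LNML density of
Theorem 2 into multivariate Student t-densities.  Here `i : Fin n` corresponds
to the paper's index `i+1`, so the prefix of the first `i` observations is used. -/
theorem lnml_sequential_decomposition (m n : ℕ) (hm : 1 ≤ m) (hn : 1 ≤ n) (ν ρ2 : ℝ)
    (hν : (m : ℝ) - 1 < ν) (hρ : 0 < ρ2)
    (μ0 : Fin m → ℝ) (S0 : Matrix (Fin m) (Fin m) ℝ) (hS0 : S0.PosDef)
    (x : Fin n → Fin m → ℝ) :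
    (ν ^ ν / (π ^ (n : ℝ) * ((n : ℝ) + ν) ^ ((n : ℝ) + ν) *
        (1 + n / (ρ2 * ν)))) ^ ((m : ℝ) / 2) *
      (multiGamma m (((n : ℝ) + ν) / 2) / multiGamma m (ν / 2)) *
      (S0.det ^ (ν / 2) / (sigmaBar2 m n ν ρ2 μ0 S0 x).det ^ (((n : ℝ) + ν) / 2))
    = ∏ i : Fin n,
        tDens m (ν - m + (i : ℕ) + 1) (x i)
          (muBar2 m (i : ℕ) ν ρ2 μ0 (fun j => x (Fin.castLE i.isLt.le j)))
          ((((ρ2 * ν + (i : ℕ) + 1) * (ν + (i : ℕ))) /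
              ((ρ2 * ν + (i : ℕ)) * (ν - m + (i : ℕ) + 1))) •
            sigmaBar2 m (i : ℕ) ν ρ2 μ0 S0 (fun j => x (Fin.castLE i.isLt.le j))) := by
  rw [← scatterMatrix_ratio_eq_prod_tDens m n ν ρ2 hm hν hρ μ0 S0 hS0 x]
  have hm' : (1 : ℝ) ≤ m := by exact_mod_cast hm
  have hν0 : 0 < ν := by linarith
  have hM := (scatterMatrix_posDef m n ν ρ2 hν0 hρ μ0 S0 hS0 x).det_pos
  have hS := hS0.det_pos
  have hc : 0 < ν + n := by positivity
  have hr : 0 < ρ2 * ν / (ρ2 * ν + n) := by positivity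
  have hr' : 1 + n / (ρ2 * ν) = (ρ2 * ν / (ρ2 * ν + n))⁻¹ := by field_simp
  rw [sigmaBar2_eq_smul_scatterMatrix, det_smul, det_smul, Fintype.card_fin, hr',
    add_comm (n : ℝ) ν, one_div, ← Real.rpow_natCast _ m, ← Real.rpow_natCast _ m]
  generalize (scatterMatrix m n ν ρ2 μ0 S0 x).det = D at *
  generalize S0.det = E at *
  generalize ρ2 * ν / (ρ2 * ν + n) = r at *
  generalize multiGamma m ((ν + n) / 2) / multiGamma m (ν / 2) = G
  rw [mul_right_comm, mul_right_comm _ G]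
  congr 1
  obtain ⟨lp, hlp⟩ := exists_eq_exp Real.pi_pos
  obtain ⟨lD, rfl⟩ := exists_eq_exp hM
  obtain ⟨lE, rfl⟩ := exists_eq_exp hS
  obtain ⟨lr, rfl⟩ := exists_eq_exp hr
  have hνpow (t : ℝ) : ν ^ t = Real.exp (Real.log ν * t) := Real.rpow_def_of_pos hν0 t
  have hcpow (t : ℝ) : (ν + n) ^ t = Real.exp (Real.log (ν + n) * t) :=
    Real.rpow_def_of_pos hc t
  rw [Real.inv_rpow hc.le, hlp]
  simp only [hνpow, hcpow, ← Real.exp_mul, ← Real.exp_neg, ← Real.exp_add, ← Real.exp_sub]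
  congr 1
  ring
end

section
/- (Marginal consistency of the LNML process.) Fix integers m ≥ 1, n ≥ 1, reals ν > m−1, ρ² > 0, a vector μ₀ ∈ ℝ^m and a positive definite Σ₀ ∈ ℝ^{m×m}. Let p̄_k denote the LNML density of Theorem 2 for sample size k. Then for every x^n ∈ (ℝ^m)^n, ∫_{ℝ^m} p̄_{n+1}(x_1,…,x_n,x_{n+1}) dx_{n+1} = p̄_n(x_1,…,x_n); hence the family (p̄_k)_{k≥1} defines a consistent stochastic process. -/
open MeasureTheory Matrix Real BigOperators

/-- The LNML density of Theorem 2 for sample size `k` (closed form). -/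
noncomputable def lnmlDens (m k : ℕ) (ν ρ2 : ℝ) (μ0 : Fin m → ℝ)
    (S0 : Matrix (Fin m) (Fin m) ℝ) (x : Fin k → Fin m → ℝ) : ℝ :=
  (ν ^ ν / (π ^ (k : ℝ) * ((k : ℝ) + ν) ^ ((k : ℝ) + ν) *
      (1 + k / (ρ2 * ν)))) ^ ((m : ℝ) / 2) *
    (multiGamma m (((k : ℝ) + ν) / 2) / multiGamma m (ν / 2)) *
    (S0.det ^ (ν / 2) / (sigmaBar2 m k ν ρ2 μ0 S0 x).det ^ (((k : ℝ) + ν) / 2))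

theorem integral_exp_neg_mul_dotProduct (m : ℕ) {t : ℝ} (ht : 0 < t) :
    ∫ v : Fin m → ℝ, Real.exp (-t * (v ⬝ᵥ v)) = (π / t) ^ ((m : ℝ) / 2) := by
  have h (v : Fin m → ℝ) : Real.exp (-t * (v ⬝ᵥ v)) = ∏ i, Real.exp (-t * v i ^ 2) := by
    simp_rw [← Real.exp_sum, dotProduct, Finset.mul_sum, pow_two]
  simp_rw [h]
  rw [integral_fintype_prod_volume_eq_pow (fun x : ℝ => Real.exp (-t * x ^ 2)),
    integral_gaussian, Fintype.card_fin, Real.sqrt_eq_rpow, ← Real.rpow_mul_natCast (by positivity)]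
  congr 1
  ring

theorem integrable_exp_neg_mul_dotProduct (m : ℕ) {t : ℝ} (ht : 0 < t) :
    Integrable fun v : Fin m → ℝ => Real.exp (-t * (v ⬝ᵥ v)) := by
  have h (v : Fin m → ℝ) : Real.exp (-t * (v ⬝ᵥ v)) = ∏ i, Real.exp (-t * v i ^ 2) := by
    simp_rw [← Real.exp_sum, dotProduct, Finset.mul_sum, pow_two]
  simp_rw [h]
  exact Integrable.fintype_prod (f := fun _ x => Real.exp (-t * x ^ 2))
    fun _ => integrable_exp_neg_mul_sq ht

theorem integral_one_add_dotProduct_rpow (m : ℕ) {p : ℝ} (hp : (m : ℝ) / 2 < p) :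
    ∫ v : Fin m → ℝ, (1 + v ⬝ᵥ v) ^ (-p) =
      π ^ ((m : ℝ) / 2) * Real.Gamma (p - m / 2) / Real.Gamma p := by
  have hm : (0 : ℝ) ≤ m / 2 := by positivity
  have hp0 : 0 < p := hm.trans_lt hp
  have hsq (v : Fin m → ℝ) : 0 ≤ v ⬝ᵥ v := by
    simpa using dotProduct_star_self_nonneg v
  let f : ℝ → (Fin m → ℝ) → ℝ := fun t v => t ^ (p - 1) * Real.exp (-((1 + v ⬝ᵥ v) * t))
  have hf (t : ℝ) (v : Fin m → ℝ) :
      f t v = t ^ (p - 1) * Real.exp (-t) * Real.exp (-t * (v ⬝ᵥ v)) := by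
    simp only [f]
    rw [mul_assoc, ← Real.exp_add]
    ring_nf
  have hint (t : ℝ) (ht : 0 < t) : ∫ v, f t v =
      π ^ ((m : ℝ) / 2) * (Real.exp (-t) * t ^ (p - m / 2 - 1)) := by
    simp_rw [hf]
    rw [integral_const_mul, integral_exp_neg_mul_dotProduct m ht,
      Real.div_rpow Real.pi_pos.le ht.le, sub_right_comm p, Real.rpow_sub ht (p - 1)]
    ring
  have hgamma := (Real.GammaIntegral_convergent (sub_pos.2 hp)).const_mul (π ^ ((m : ℝ) / 2))
  have hfint : Integrable (Function.uncurry f)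
      ((volume.restrict (Set.Ioi (0 : ℝ))).prod (volume : Measure (Fin m → ℝ))) := by
    refine (integrable_prod_iff ?_).2 ⟨?_, ?_⟩
    · apply Measurable.aestronglyMeasurable
      simp only [f, Function.uncurry_def, dotProduct]
      fun_prop
    · filter_upwards [ae_restrict_mem measurableSet_Ioi] with t ht
      simp only [Function.uncurry_apply_pair, hf]
      exact (integrable_exp_neg_mul_dotProduct m ht).const_mul _
    · refine hgamma.congr ?_
      filter_upwards [ae_restrict_mem measurableSet_Ioi] with t ht
      rw [← hint t ht]
      refine integral_congr_ae (ae_of_all _ fun v => ?_)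
      have ht' : 0 < t := ht
      exact (Real.norm_of_nonneg (show 0 ≤ f t v by simp only [f]; positivity)).symm
  have hswap := integral_integral_swap hfint
  have hleft : ∫ t in Set.Ioi (0 : ℝ), ∫ v, f t v =
      π ^ ((m : ℝ) / 2) * Real.Gamma (p - m / 2) := by
    rw [setIntegral_congr_fun measurableSet_Ioi hint, integral_const_mul,
      Real.Gamma_eq_integral (sub_pos.2 hp)]
  have hright (v : Fin m → ℝ) :
      ∫ t in Set.Ioi (0 : ℝ), f t v = (1 + v ⬝ᵥ v) ^ (-p) * Real.Gamma p := by
    have hv : 0 < 1 + v ⬝ᵥ v := add_pos_of_pos_of_nonneg one_pos (hsq v)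
    rw [Real.integral_rpow_mul_exp_neg_mul_Ioi hp0 hv, one_div, Real.inv_rpow hv.le,
      Real.rpow_neg hv.le]
  simp_rw [hright] at hswap
  rw [hleft, integral_mul_const] at hswap
  rw [hswap, mul_div_cancel_right₀ _ (Real.Gamma_pos_of_pos hp0).ne']

theorem integral_comp_mulVec {m : ℕ} {B : Matrix (Fin m) (Fin m) ℝ} (hB : B.det ≠ 0)
    (g : (Fin m → ℝ) → ℝ) :
    ∫ u, g u = |B.det| * ∫ v, g (B *ᵥ v) := by
  have hmap := Real.map_matrix_volume_pi_eq_smul_volume_pi hB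
  let e : (Fin m → ℝ) ≃L[ℝ] (Fin m → ℝ) :=
    (Matrix.toLinearEquiv' B
      ((Matrix.isUnit_iff_isUnit_det B).2 hB.isUnit).invertible).toContinuousLinearEquiv
  have he : MeasurableEmbedding (toLin' B) := e.toHomeomorph.measurableEmbedding
  have h := he.integral_map (μ := volume) g
  rw [hmap, integral_smul_measure, ENNReal.toReal_ofReal (abs_nonneg _), smul_eq_mul] at h
  simp only [toLin'_apply] at h
  rw [← h, abs_inv, mul_inv_cancel_left₀ (abs_ne_zero.2 hB)]

theorem Matrix.PosDef.exists_eq_mul_transpose {m : ℕ} {A : Matrix (Fin m) (Fin m) ℝ}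
    (hA : A.PosDef) : ∃ B : Matrix (Fin m) (Fin m) ℝ, A = B * Bᵀ := by
  open scoped MatrixOrder in
  obtain ⟨B, hB⟩ := CStarAlgebra.nonneg_iff_eq_star_mul_self.mp hA.posSemidef.nonneg
  exact ⟨Bᵀ, by simpa [star_eq_conjTranspose, conjTranspose_eq_transpose_of_trivial] using hB⟩

theorem det_mul_transpose_add_vecMulVec {m : ℕ} (B : Matrix (Fin m) (Fin m) ℝ) (v : Fin m → ℝ) :
    (B * Bᵀ + vecMulVec (B *ᵥ v) (B *ᵥ v)).det = (B * Bᵀ).det * (1 + v ⬝ᵥ v) := by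
  have h : B * Bᵀ + vecMulVec (B *ᵥ v) (B *ᵥ v) = B * (1 + vecMulVec v v) * Bᵀ := by
    rw [Matrix.mul_add, Matrix.add_mul, mul_vecMulVec, vecMulVec_mul, vecMul_transpose,
      Matrix.mul_one]
  rw [h, det_mul, det_mul, det_mul, vecMulVec_eq Unit, det_one_add_replicateCol_mul_replicateRow]
  ring

theorem integral_det_add_smul_vecMulVec_rpow {m : ℕ} {A : Matrix (Fin m) (Fin m) ℝ}
    (hA : A.PosDef) {a p : ℝ} (ha : 0 < a) (hp : (m : ℝ) / 2 < p) (b : Fin m → ℝ) :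
    ∫ y, (A + a • vecMulVec (y - b) (y - b)).det ^ (-p) =
      A.det ^ (-(p - 1 / 2)) * a ^ (-((m : ℝ) / 2)) *
        (π ^ ((m : ℝ) / 2) * Real.Gamma (p - m / 2) / Real.Gamma p) := by
  obtain ⟨B, hB⟩ := (hA.smul (inv_pos.2 ha)).exists_eq_mul_transpose
  have hdetA := hA.det_pos
  have hAB : A = a • (B * Bᵀ) := by rw [← hB, smul_inv_smul₀ ha.ne']
  have hdet : B.det ^ 2 = a⁻¹ ^ m * A.det := by
    have := congrArg det hB
    rw [det_smul, det_mul, det_transpose, Fintype.card_fin] at this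
    rw [this, pow_two]
  have hBdet : B.det ≠ 0 := by
    intro h
    rw [h] at hdet
    have : 0 < a⁻¹ ^ m * A.det := by positivity
    rw [← hdet] at this
    simp at this
  have habs : |B.det| = a ^ (-((m : ℝ) / 2)) * A.det ^ (1 / 2 : ℝ) := by
    rw [← Real.sqrt_sq_eq_abs, hdet, Real.sqrt_mul (by positivity), Real.sqrt_eq_rpow,
      Real.sqrt_eq_rpow, ← Real.rpow_natCast_mul (by positivity), Real.inv_rpow ha.le,
      ← Real.rpow_neg ha.le]
    ring_nf
  have hsub (v : Fin m → ℝ) : (A + a • vecMulVec (B *ᵥ v) (B *ᵥ v)).det ^ (-p) =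
      A.det ^ (-p) * (1 + v ⬝ᵥ v) ^ (-p) := by
    have hv : 0 ≤ v ⬝ᵥ v := by simpa using dotProduct_star_self_nonneg v
    rw [← Real.mul_rpow hdetA.le (by positivity)]
    congr 1
    conv_lhs => rw [hAB, ← smul_add, det_smul, det_mul_transpose_add_vecMulVec, ← mul_assoc,
      ← det_smul, ← hAB]
  rw [integral_sub_right_eq_self (fun u => (A + a • vecMulVec u u).det ^ (-p)) b,
    integral_comp_mulVec hBdet]
  simp_rw [hsub]
  rw [integral_const_mul, integral_one_add_dotProduct_rpow m hp, habs,
    show -(p - 1 / 2) = 1 / 2 + -p by ring, Real.rpow_add hdetA]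
  ring

theorem multiGamma_mul_Gamma (m : ℕ) (p : ℝ) :
    multiGamma m p * Real.Gamma (p - m / 2) = multiGamma m (p - 1 / 2) * Real.Gamma p := by
  have h : ∀ k : ℕ, (∏ j : Fin k, Real.Gamma (p - (j : ℝ) / 2)) * Real.Gamma (p - k / 2) =
      (∏ j : Fin k, Real.Gamma (p - 1 / 2 - (j : ℝ) / 2)) * Real.Gamma p := by
    intro k
    induction k with
    | zero => simp
    | succ k ih =>
      rw [Fin.prod_univ_castSucc, Fin.prod_univ_castSucc]
      simp only [Fin.val_castSucc, Fin.val_last]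
      rw [ih, show p - 1 / 2 - (k : ℝ) / 2 = p - (k + 1 : ℕ) / 2 by push_cast; ring]
      ring
  rw [multiGamma, multiGamma, mul_assoc, mul_assoc, h]

/-- The matrix `Σ̄_k` multiplied by `k + ν`. -/
noncomputable def scatter (m k : ℕ) (ν ρ2 : ℝ) (μ0 : Fin m → ℝ)
    (S0 : Matrix (Fin m) (Fin m) ℝ) (x : Fin k → Fin m → ℝ) : Matrix (Fin m) (Fin m) ℝ :=
  ∑ i, vecMulVec (x i - μ0) (x i - μ0) + ν • S0 -
    (1 / (ρ2 * ν + k)) • vecMulVec (∑ i, (x i - μ0)) (∑ i, (x i - μ0))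

theorem sigmaBar2_eq_smul_scatter (m k : ℕ) {ν ρ2 : ℝ} (μ0 : Fin m → ℝ)
    (S0 : Matrix (Fin m) (Fin m) ℝ) (x : Fin k → Fin m → ℝ) :
    sigmaBar2 m k ν ρ2 μ0 S0 x = (1 / (k + ν)) • scatter m k ν ρ2 μ0 S0 x := by
  have h : ∑ i, ∑ j, vecMulVec (x i - μ0) (x j - μ0) =
      vecMulVec (∑ i, (x i - μ0)) (∑ i, (x i - μ0)) := by
    ext a b
    simp only [Matrix.sum_apply, vecMulVec_apply, Finset.sum_apply, Finset.sum_mul_sum]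
  rw [sigmaBar2, scatter, h, smul_sub, smul_smul]
  congr 2
  rw [add_comm ν, one_div_mul_one_div]

theorem scatter_snoc (m k : ℕ) {ν ρ2 : ℝ} (hc : 0 < ρ2 * ν) (μ0 : Fin m → ℝ)
    (S0 : Matrix (Fin m) (Fin m) ℝ) (x : Fin k → Fin m → ℝ) (y : Fin m → ℝ) :
    scatter m (k + 1) ν ρ2 μ0 S0 (Fin.snoc x y : Fin (k + 1) → Fin m → ℝ) =
      scatter m k ν ρ2 μ0 S0 x + ((ρ2 * ν + k) / (ρ2 * ν + k + 1)) •
        vecMulVec (y - muBar2 m k ν ρ2 μ0 x) (y - muBar2 m k ν ρ2 μ0 x) := by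
  have h1 : ρ2 * ν + k ≠ 0 := by positivity
  have h2 : ρ2 * ν + k + 1 ≠ 0 := by positivity
  rw [scatter, scatter, muBar2, Fin.sum_univ_castSucc, Fin.sum_univ_castSucc]
  simp only [Fin.snoc_castSucc, Fin.snoc_last]
  generalize ∑ i, (x i - μ0) = s
  generalize ∑ i, vecMulVec (x i - μ0) (x i - μ0) = M
  ext a b
  simp only [Matrix.add_apply, Matrix.sub_apply, Matrix.smul_apply, vecMulVec_apply, Pi.add_apply,
    Pi.sub_apply, Pi.smul_apply, smul_eq_mul, Nat.cast_succ, ← add_assoc, add_comm (k : ℝ) (ρ2 * ν)]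
  generalize ρ2 * ν + k = q at h1 h2 ⊢
  field_simp
  ring

theorem posDef_scatter (m k : ℕ) {ν ρ2 : ℝ} (hν : 0 < ν) (hρ : 0 < ρ2) (μ0 : Fin m → ℝ)
    {S0 : Matrix (Fin m) (Fin m) ℝ} (hS0 : S0.PosDef) (x : Fin k → Fin m → ℝ) :
    (scatter m k ν ρ2 μ0 S0 x).PosDef := by
  induction k with
  | zero => simpa [scatter] using hS0.smul hν
  | succ k ih =>
    rw [← Fin.snoc_init_self x, scatter_snoc m k (mul_pos hρ hν)]
    refine (ih _).add_posSemidef (PosSemidef.smul ?_ (by positivity))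
    simpa using posSemidef_vecMulVec_self_star (R := ℝ) _

theorem lnmlDens_eq_det_scatter (m k : ℕ) {ν ρ2 : ℝ} (hν : 0 < ν) (hρ : 0 < ρ2) (μ0 : Fin m → ℝ)
    {S0 : Matrix (Fin m) (Fin m) ℝ} (hS0 : S0.PosDef) (x : Fin k → Fin m → ℝ) :
    lnmlDens m k ν ρ2 μ0 S0 x =
      (ν ^ ν) ^ ((m : ℝ) / 2) * S0.det ^ (ν / 2) / multiGamma m (ν / 2) *
        (((π ^ ((m : ℝ) / 2)) ^ k)⁻¹ * (1 + k / (ρ2 * ν)) ^ (-((m : ℝ) / 2)) *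
          multiGamma m ((k + ν) / 2)) *
        (scatter m k ν ρ2 μ0 S0 x).det ^ (-(((k : ℝ) + ν) / 2)) := by
  have hdet := (posDef_scatter m k hν hρ μ0 hS0 x).det_pos
  have hk : 0 < (k : ℝ) + ν := by positivity
  have hpow : (((k : ℝ) + ν) ^ ((k : ℝ) + ν)) ^ ((m : ℝ) / 2) =
      (((k : ℝ) + ν) ^ m) ^ (((k : ℝ) + ν) / 2) := by
    rw [← Real.rpow_mul hk.le, ← Real.rpow_natCast_mul hk.le]
    ring_nf
  have hpi : (π ^ (k : ℝ)) ^ ((m : ℝ) / 2) = (π ^ ((m : ℝ) / 2)) ^ k := by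
    rw [← Real.rpow_mul Real.pi_pos.le, ← Real.rpow_mul_natCast Real.pi_pos.le, mul_comm]
  rw [lnmlDens, sigmaBar2_eq_smul_scatter, det_smul, Fintype.card_fin, _root_.one_div_pow,
    Real.mul_rpow (by positivity) hdet.le, one_div, Real.inv_rpow (by positivity), ← hpow,
    Real.div_rpow (by positivity) (by positivity), Real.mul_rpow (by positivity) (by positivity),
    Real.mul_rpow (by positivity) (by positivity), hpi, Real.rpow_neg hdet.le,
    Real.rpow_neg (by positivity)]
  field_simp

/-- marginal consistency of the LNML process: integrating the
`(n+1)`-sample LNML density over the last observation recovers the `n`-sample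
LNML density. -/
theorem lnml_marginal_consistency (m n : ℕ) (hm : 1 ≤ m) (hn : 1 ≤ n) (ν ρ2 : ℝ)
    (hν : (m : ℝ) - 1 < ν) (hρ : 0 < ρ2)
    (μ0 : Fin m → ℝ) (S0 : Matrix (Fin m) (Fin m) ℝ) (hS0 : S0.PosDef)
    (x : Fin n → Fin m → ℝ) :
    ∫ y : Fin m → ℝ, lnmlDens m (n + 1) ν ρ2 μ0 S0 (Fin.snoc x y)
      = lnmlDens m n ν ρ2 μ0 S0 x := by
  have hm' : (1 : ℝ) ≤ m := by exact_mod_cast hm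
  have hn' : (1 : ℝ) ≤ n := by exact_mod_cast hn
  have hν0 : 0 < ν := by linarith
  have hc : 0 < ρ2 * ν := mul_pos hρ hν0
  have ha : 0 < (ρ2 * ν + n) / (ρ2 * ν + n + 1) := by positivity
  have hp : (m : ℝ) / 2 < (((n + 1 : ℕ) : ℝ) + ν) / 2 := by push_cast; linarith
  have hΓ : 0 < Real.Gamma ((((n + 1 : ℕ) : ℝ) + ν) / 2) :=
    Real.Gamma_pos_of_pos (by positivity)
  have hmul := multiGamma_mul_Gamma m ((((n + 1 : ℕ) : ℝ) + ν) / 2)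
  have hfactor : (1 + ((n + 1 : ℕ) : ℝ) / (ρ2 * ν)) ^ (-((m : ℝ) / 2)) *
      ((ρ2 * ν + n) / (ρ2 * ν + n + 1)) ^ (-((m : ℝ) / 2)) =
      (1 + (n : ℝ) / (ρ2 * ν)) ^ (-((m : ℝ) / 2)) := by
    rw [← Real.mul_rpow (by positivity) ha.le]
    congr 1
    push_cast
    field_simp
    ring
  have hpn : (((n + 1 : ℕ) : ℝ) + ν) / 2 - 1 / 2 = ((n : ℝ) + ν) / 2 := by push_cast; ring
  simp_rw [lnmlDens_eq_det_scatter m _ hν0 hρ μ0 hS0, scatter_snoc m n hc]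
  rw [integral_const_mul, integral_det_add_smul_vecMulVec_rpow
    (posDef_scatter m n hν0 hρ μ0 hS0 x) ha hp, ← hfactor]
  rw [hpn] at hmul ⊢
  rw [eq_div_of_mul_eq hΓ.ne' hmul.symm, pow_succ]
  have hπ : π ^ ((m : ℝ) / 2) ≠ 0 := by positivity
  field_simp
end
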